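/- The Equality Shortest Path (ESP) problem is undecidable: there is no algorithm that, given a finite two-player zero-sum multidimensional shortest path game (a finite arena with players Eve and Adam, t weight functions w_i : E → ℤ, and a target set T ⊆ V), an initial vertex v_0, and a threshold c̄ ∈ ℤ^t, decides whether Eve has a strategy σ_E such that every play from v_0 consistent with σ_E has cost tuple exactly c̄. Formally, under a natural effective encoding of such finite instances as natural numbers, the set of encodings of positive instances is not a decidable (computable) set. -/

import Mathlib

open scoped Classical

/-- An infinite play in the graph with edge relation `E`. -/
def IsPlay {V : Type*} (E : V → V → Prop) (π : ℕ → V) : Prop :=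
  ∀ k, E (π k) (π (k + 1))

/-- The history `π 0, …, π k` as a list. -/
def histList {V : Type*} (π : ℕ → V) (k : ℕ) : List V :=
  (List.range (k + 1)).map π

/-- The cost (in `ℤ ∪ {+∞}`) of a play for the integer weight function `w` and the
target set `T`: the accumulated weight up to the first visit of `T`, and `+∞` if `T`
is never visited. -/
noncomputable def costZ {V : Type*} (w : V → V → ℤ) (T : Set V) (π : ℕ → V) :
    WithTop ℤ :=
  if h : ∃ n, π n ∈ T then
    ((∑ j ∈ Finset.range (Nat.find h), w (π j) (π (j + 1)) : ℤ) : WithTop ℤ)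
  else ⊤

/-- `σ` is a strategy for the player owning the set of vertices `Vi`. -/
def IsStrategy {V : Type*} (E : V → V → Prop) (Vi : Set V) (σ : List V → V) : Prop :=
  ∀ (l : List V) (u : V), List.Chain' E (l ++ [u]) → u ∈ Vi → E u (σ (l ++ [u]))

/-- A play is consistent with the strategy `σ` of the player owning `Vi`. -/
def PlayConsistent {V : Type*} (Vi : Set V) (σ : List V → V) (π : ℕ → V) : Prop :=
  ∀ k, π k ∈ Vi → π (k + 1) = σ (histList π k)

/-- A finite instance of the Equality Shortest Path problem: `n` vertices
`0, …, n-1`, a list of edges, the list of vertices of Eve (Adam owns the others),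
`t` integer weight functions given by lists of weighted edges, a single target set,
an initial vertex and a threshold tuple `c̄ ∈ ℤ^t`. -/
structure ESPInstance where
  n : ℕ
  t : ℕ
  edges : List (ℕ × ℕ)
  eve : List ℕ
  w : List (List (ℕ × ℕ × ℤ))
  tgt : List ℕ
  v0 : ℕ
  cbar : List ℤ

namespace ESPInstance

/-- A natural effective encoding of instances. -/
def encEquiv : ESPInstance ≃
    ℕ × ℕ × List (ℕ × ℕ) × List ℕ × List (List (ℕ × ℕ × ℤ)) × List ℕ × ℕ × List ℤ where
  toFun I := (I.n, I.t, I.edges, I.eve, I.w, I.tgt, I.v0, I.cbar)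
  invFun p := ⟨p.1, p.2.1, p.2.2.1, p.2.2.2.1, p.2.2.2.2.1, p.2.2.2.2.2.1,
    p.2.2.2.2.2.2.1, p.2.2.2.2.2.2.2⟩
  left_inv I := rfl
  right_inv p := rfl

instance : Primcodable ESPInstance := Primcodable.ofEquiv _ encEquiv

/-- The edge relation of the instance, on the vertex set `Fin I.n`. -/
def Edge (I : ESPInstance) (u v : Fin I.n) : Prop :=
  ((u : ℕ), (v : ℕ)) ∈ I.edges

/-- The set of vertices owned by Eve. -/
def eveSet (I : ESPInstance) : Set (Fin I.n) := {v | (v : ℕ) ∈ I.eve}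

/-- The weight function of dimension `i`. -/
def weight (I : ESPInstance) (i : Fin I.t) (u v : Fin I.n) : ℤ :=
  (((I.w.getD (i : ℕ) []).filter fun p => p.1 == (u : ℕ) && p.2.1 == (v : ℕ)).map
    fun p => p.2.2).sum

/-- The target set. -/
def target (I : ESPInstance) : Set (Fin I.n) := {v | (v : ℕ) ∈ I.tgt}

/-- The instance is positive: it is well formed (the initial vertex exists, every
vertex has a successor, and the threshold tuple has `t` entries) and Eve has a
strategy `σE` such that every play from `v0` consistent with `σE` has cost tuple
exactly `c̄`. -/
def Positive (I : ESPInstance) : Prop :=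
  ∃ h0 : I.v0 < I.n,
    (∀ u : Fin I.n, ∃ v : Fin I.n, I.Edge u v) ∧ I.cbar.length = I.t ∧
    ∃ σE : List (Fin I.n) → Fin I.n, IsStrategy I.Edge I.eveSet σE ∧
      ∀ π : ℕ → Fin I.n, IsPlay I.Edge π → π 0 = ⟨I.v0, h0⟩ →
        PlayConsistent I.eveSet σE π →
        ∀ i : Fin I.t, costZ (I.weight i) I.target π =
          ((I.cbar.getD (i : ℕ) 0 : ℤ) : WithTop ℤ)

end ESPInstance

section ReachabilityGame

variable {V ι : Type*}

/-- Eve can force a visit of `T` within fewer than `k` moves from `v`, with accumulated weight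
exactly `r` at the first visit. -/
def WinWithin (E : V → V → Prop) (eve T : Set V) (w : V → V → ι → ℤ) :
    ℕ → V → (ι → ℤ) → Prop
  | 0, _, _ => False
  | k + 1, v, r =>
    (v ∈ T ∧ r = 0) ∨
    (v ∉ T ∧ v ∈ eve ∧ ∃ u, E v u ∧ WinWithin E eve T w k u (r - w v u)) ∨
    (v ∉ T ∧ v ∉ eve ∧ ∀ u, E v u → WinWithin E eve T w k u (r - w v u))

/-- Eve can force a visit of `T` from `v` with accumulated weight exactly `r`. -/
def Winning (E : V → V → Prop) (eve T : Set V) (w : V → V → ι → ℤ) (v : V) (r : ι → ℤ) : Prop :=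
  ∃ k, WinWithin E eve T w k v r

variable {E : V → V → Prop} {eve T : Set V} {w : V → V → ι → ℤ}

theorem WinWithin.mono {k m : ℕ} (hkm : k ≤ m) {v : V} {r : ι → ℤ}
    (h : WinWithin E eve T w k v r) : WinWithin E eve T w m v r := by
  induction k generalizing m v r with
  | zero => exact h.elim
  | succ k ih =>
    obtain ⟨m, rfl⟩ : ∃ m', m = m' + 1 := ⟨m - 1, by omega⟩
    have hkm' : k ≤ m := by omega
    rcases h with h | ⟨h₁, h₂, u, hu, h⟩ | ⟨h₁, h₂, h⟩
    · exact Or.inl h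
    · exact Or.inr (Or.inl ⟨h₁, h₂, u, hu, ih hkm' h⟩)
    · exact Or.inr (Or.inr ⟨h₁, h₂, fun u hu => ih hkm' (h u hu)⟩)

theorem winning_of_mem_target {v : V} (hv : v ∈ T) : Winning E eve T w v 0 :=
  ⟨1, Or.inl ⟨hv, rfl⟩⟩

theorem winning_of_eve {v u : V} {r : ι → ℤ} (hT : v ∉ T) (hv : v ∈ eve) (hE : E v u)
    (h : Winning E eve T w u (r - w v u)) : Winning E eve T w v r := by
  obtain ⟨k, h⟩ := h
  exact ⟨k + 1, Or.inr (Or.inl ⟨hT, hv, u, hE, h⟩)⟩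

theorem winning_of_adam [Finite V] {v : V} {r : ι → ℤ} (hT : v ∉ T) (hv : v ∉ eve)
    (h : ∀ u, E v u → Winning E eve T w u (r - w v u)) : Winning E eve T w v r := by
  have := Fintype.ofFinite V
  have h' : ∀ u, ∃ k, E v u → WinWithin E eve T w k u (r - w v u) := by
    intro u
    by_cases hu : E v u
    · obtain ⟨k, hk⟩ := h u hu
      exact ⟨k, fun _ => hk⟩
    · exact ⟨0, fun hu' => absurd hu' hu⟩
  choose k hk using h'
  exact ⟨Finset.univ.sup k + 1, Or.inr (Or.inr ⟨hT, hv, fun u hu =>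
    (hk u hu).mono (Finset.le_sup (Finset.mem_univ u))⟩)⟩

/-- The weight vector accumulated along the first `k` moves of `π`. -/
def accum (w : V → V → ι → ℤ) (π : ℕ → V) (k : ℕ) : ι → ℤ :=
  ∑ j ∈ Finset.range k, w (π j) (π (j + 1))

theorem accum_succ (π : ℕ → V) (k : ℕ) :
    accum w π (k + 1) = accum w π k + w (π k) (π (k + 1)) :=
  Finset.sum_range_succ _ _

theorem accum_congr {π ρ : ℕ → V} {k : ℕ} (h : ∀ j ≤ k, π j = ρ j) :
    accum w π k = accum w ρ k := by
  refine Finset.sum_congr rfl fun j hj => ?_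
  rw [Finset.mem_range] at hj
  rw [h j hj.le, h (j + 1) hj]

theorem histList_length (π : ℕ → V) (k : ℕ) : (histList π k).length = k + 1 := by
  simp [histList]

theorem histList_getD (π : ℕ → V) {j k : ℕ} (h : j ≤ k) (d : V) :
    (histList π k).getD j d = π j := by
  simp [histList, List.getD_eq_getElem?_getD, List.getElem?_range (Nat.lt_succ_of_le h)]

theorem histList_succ (π : ℕ → V) (k : ℕ) :
    histList π (k + 1) = histList π k ++ [π (k + 1)] := by
  simp [histList, List.range_succ (n := k + 1)]

/-- If Eve wins from `v₀` with weight `c`, some strategy guarantees that the first visit of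
`T` happens, with accumulated weight `c`. -/
theorem exists_strategy_of_winning (hE : ∀ u, ∃ v, E u v) {v₀ : V} {c : ι → ℤ}
    (h : Winning E eve T w v₀ c) :
    ∃ σ : List V → V, IsStrategy E eve σ ∧
      ∀ π : ℕ → V, IsPlay E π → π 0 = v₀ → PlayConsistent eve σ π →
        ∃ n, π n ∈ T ∧ (∀ m < n, π m ∉ T) ∧ accum w π n = c := by
  obtain ⟨K, hK⟩ := h
  have key : ∀ l : List V, ∃ v : V,
      E (l.getD (l.length - 1) v₀) v ∧
      ((∃ u, E (l.getD (l.length - 1) v₀) u ∧ WinWithin E eve T w (K - l.length) u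
        (c - accum w (fun j => l.getD j v₀) (l.length - 1) -
          w (l.getD (l.length - 1) v₀) u)) →
        WinWithin E eve T w (K - l.length) v
          (c - accum w (fun j => l.getD j v₀) (l.length - 1) -
            w (l.getD (l.length - 1) v₀) v)) := by
    intro l
    by_cases hl : ∃ u, E (l.getD (l.length - 1) v₀) u ∧ WinWithin E eve T w (K - l.length) u
        (c - accum w (fun j => l.getD j v₀) (l.length - 1) -
          w (l.getD (l.length - 1) v₀) u)
    · obtain ⟨u, hu, hw⟩ := hl
      exact ⟨u, hu, fun _ => hw⟩
    · obtain ⟨v, hv⟩ := hE (l.getD (l.length - 1) v₀)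
      exact ⟨v, hv, fun hl' => absurd hl' hl⟩
  choose σ hσE hσ using key
  refine ⟨σ, fun l u _ _ => by simpa using hσE (l ++ [u]), fun π hπ hπ0 hcon => ?_⟩
  have inv : ∀ k, (∀ m < k, π m ∉ T) →
      WinWithin E eve T w (K - k) (π k) (c - accum w π k) := by
    intro k
    induction k with
    | zero =>
      intro _
      simpa [accum, hπ0] using hK
    | succ k ih =>
      intro hT
      have hk := ih fun m hm => hT m (by omega)
      have hTk := hT k (Nat.lt_succ_self k)
      obtain ⟨j, hj⟩ : ∃ j, K - k = j + 1 := by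
        rcases Nat.eq_zero_or_pos (K - k) with h0 | h0
        · rw [h0] at hk
          exact hk.elim
        · exact ⟨K - k - 1, by omega⟩
      have hj' : K - (k + 1) = j := by omega
      rw [hj] at hk
      rw [hj', accum_succ, ← sub_sub]
      rcases hk with hk | ⟨_, he, u, hu, hw⟩ | ⟨_, _, hw⟩
      · exact absurd hk.1 hTk
      · have hlast : (histList π k).getD ((histList π k).length - 1) v₀ = π k := by
          rw [histList_length]
          exact histList_getD π le_rfl v₀
        have hacc : accum w (fun i => (histList π k).getD i v₀) ((histList π k).length - 1)
            = accum w π k := by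
          rw [histList_length]
          exact accum_congr fun i hi => histList_getD π hi v₀
        have hs := hσ (histList π k)
        rw [hlast, hacc, histList_length, hj'] at hs
        rw [hcon k he]
        exact hs ⟨u, hu, hw⟩
      · exact hw _ (hπ k)
  have hex : ∃ n, π n ∈ T := by
    by_contra! hno
    have := inv K fun m _ => hno m
    rw [Nat.sub_self] at this
    exact this
  refine ⟨Nat.find hex, Nat.find_spec hex, fun m hm => Nat.find_min hex hm, ?_⟩
  have hw := inv (Nat.find hex) fun m hm => Nat.find_min hex hm
  generalize K - Nat.find hex = j at hw
  cases j with
  | zero => exact hw.elim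
  | succ j =>
    rcases hw with hw | hw | hw
    · exact (sub_eq_zero.1 hw.2).symm
    · exact absurd (Nat.find_spec hex) hw.1
    · exact absurd (Nat.find_spec hex) hw.1

/-- If some strategy of Eve guarantees that the first visit of `T` happens, with accumulated
weight `c`, then Eve wins from `v₀` with weight `c`. -/
theorem winning_of_exists_strategy [Finite V] (hE : ∀ u, ∃ v, E u v) {v₀ : V} {c : ι → ℤ}
    {σ : List V → V} (hσ : IsStrategy E eve σ)
    (h : ∀ π : ℕ → V, IsPlay E π → π 0 = v₀ → PlayConsistent eve σ π →
        ∃ n, π n ∈ T ∧ (∀ m < n, π m ∉ T) ∧ accum w π n = c) :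
    Winning E eve T w v₀ c := by
  by_contra hlose
  have key : ∀ (u : V) (r : ι → ℤ), ∃ v, E u v ∧
      (u ∉ T → u ∉ eve → ¬ Winning E eve T w u r → ¬ Winning E eve T w v (r - w u v)) := by
    intro u r
    by_cases hu : u ∉ T ∧ u ∉ eve ∧ ¬ Winning E eve T w u r
    · obtain ⟨h1, h2, h3⟩ := hu
      by_contra! hno
      exact h3 (winning_of_adam h1 h2 fun v hv => (hno v hv).2.2.2)
    · obtain ⟨v, hv⟩ := hE u
      exact ⟨v, hv, fun h1 h2 h3 => absurd ⟨h1, h2, h3⟩ hu⟩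
  choose τ hτE hτ using key
  -- the triples (history, current vertex, remaining weight) along the play
  let next : List V × V × (ι → ℤ) → V := fun s =>
    if s.2.1 ∈ eve then σ s.1 else τ s.2.1 s.2.2
  let S : ℕ → List V × V × (ι → ℤ) := fun k => Nat.rec ([v₀], v₀, c)
    (fun _ s => (s.1 ++ [next s], next s, s.2.2 - w s.2.1 (next s))) k
  let π : ℕ → V := fun k => (S k).2.1
  have hS : ∀ k, S (k + 1) =
      ((S k).1 ++ [next (S k)], next (S k), (S k).2.2 - w (S k).2.1 (next (S k))) :=
    fun _ => rfl
  have hπ : ∀ k, π (k + 1) = next (S k) := fun _ => rfl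
  have hhist : ∀ k, histList π k = (S k).1 := by
    intro k
    induction k with
    | zero => rfl
    | succ k ih => rw [histList_succ, ih, hπ, hS]
  have hrem : ∀ k, (S k).2.2 = c - accum w π k := by
    intro k
    induction k with
    | zero => simp [accum, S]
    | succ k ih => rw [accum_succ, ← sub_sub, ← ih, hπ, hS]
  have hchain : ∀ k, List.IsChain E (histList π k) ∧ E (π k) (π (k + 1)) := by
    have step : ∀ k, List.IsChain E (histList π k) → E (π k) (π (k + 1)) := by
      intro k hk
      rw [hπ]
      by_cases he : π k ∈ eve
      · have hn : next (S k) = σ (histList π k) := by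
          rw [hhist]
          exact if_pos he
        rw [hn]
        cases k with
        | zero => exact hσ [] (π 0) (List.isChain_singleton _) he
        | succ k =>
          rw [histList_succ] at hk ⊢
          exact hσ (histList π k) (π (k + 1)) hk he
      · have hn : next (S k) = τ (π k) (S k).2.2 := if_neg he
        rw [hn]
        exact hτE _ _
    intro k
    induction k with
    | zero =>
      have h0 : List.IsChain E (histList π 0) := List.isChain_singleton _
      exact ⟨h0, step 0 h0⟩
    | succ k ih =>
      have h1 : List.IsChain E (histList π (k + 1)) := by
        rw [histList_succ]
        refine List.isChain_append.2 ⟨ih.1, List.isChain_singleton _, ?_⟩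
        intro x hx y hy
        have hx' : x = π k := by
          cases k with
          | zero => simpa [histList, eq_comm] using hx
          | succ k => simpa [histList_succ, eq_comm] using hx
        have hy' : y = π (k + 1) := by simpa [eq_comm] using hy
        rw [hx', hy']
        exact ih.2
      exact ⟨h1, step _ h1⟩
  have hcon : PlayConsistent eve σ π := by
    intro k hk
    rw [hπ, hhist]
    exact if_pos hk
  obtain ⟨n, hn, hmin, hacc⟩ := h π (fun k => (hchain k).2) rfl hcon
  have inv : ∀ k ≤ n, ¬ Winning E eve T w (π k) (c - accum w π k) := by
    intro k
    induction k with
    | zero =>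
      intro _
      rw [accum, Finset.sum_range_zero, sub_zero]
      exact hlose
    | succ k ih =>
      intro hk
      have hw := ih (by omega)
      have hT := hmin k (by omega)
      rw [accum_succ, ← sub_sub]
      by_cases he : π k ∈ eve
      · exact fun hw' => hw (winning_of_eve hT he (hchain k).2 hw')
      · have hn : π (k + 1) = τ (π k) (c - accum w π k) := by
          rw [hπ, ← hrem]
          exact if_neg he
        rw [hn]
        exact hτ _ _ hT he hw
  refine inv n le_rfl ?_
  rw [hacc, sub_self]
  exact winning_of_mem_target hn

/-- Winning is preserved and reflected by an embedding onto a successor-closed part. -/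
theorem winWithin_embedding {V' : Type*} {E' : V' → V' → Prop} {eve' T' : Set V'}
    {w' : V' → V' → ι → ℤ} (f : V → V')
    (hE : ∀ v u, E v u ↔ E' (f v) (f u)) (hclosed : ∀ v u', E' (f v) u' → ∃ u, f u = u')
    (heve : ∀ v, v ∈ eve ↔ f v ∈ eve') (hT : ∀ v, v ∈ T ↔ f v ∈ T')
    (hw : ∀ v u, E v u → w v u = w' (f v) (f u)) (k : ℕ) (v : V) (r : ι → ℤ) :
    WinWithin E eve T w k v r ↔ WinWithin E' eve' T' w' k (f v) r := by
  induction k generalizing v r with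
  | zero => exact Iff.rfl
  | succ k ih =>
    simp only [WinWithin, ← heve, ← hT]
    refine or_congr Iff.rfl (or_congr (and_congr_right fun _ => and_congr_right fun _ => ?_)
      (and_congr_right fun _ => and_congr_right fun _ => ?_))
    · constructor
      · rintro ⟨u, hu, h⟩
        exact ⟨f u, (hE v u).1 hu, by rwa [← ih, ← hw v u hu]⟩
      · rintro ⟨u', hu', h⟩
        obtain ⟨u, rfl⟩ := hclosed v u' hu'
        have hu := (hE v u).2 hu'
        exact ⟨u, hu, by rwa [ih, hw v u hu]⟩
    · constructor
      · intro h u' hu'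
        obtain ⟨u, rfl⟩ := hclosed v u' hu'
        have hu := (hE v u).2 hu'
        rw [← ih, ← hw v u hu]
        exact h u hu
      · intro h u hu
        rw [ih, hw v u hu]
        exact h _ ((hE v u).1 hu)

end ReachabilityGame

namespace ESPInstance

theorem costZ_eq_coe_iff {V : Type*} (w : V → V → ℤ) (T : Set V) (π : ℕ → V) (c : ℤ) :
    costZ w T π = (c : WithTop ℤ) ↔ ∃ n, π n ∈ T ∧ (∀ m < n, π m ∉ T) ∧
      ∑ j ∈ Finset.range n, w (π j) (π (j + 1)) = c := by
  unfold costZ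
  split_ifs with h
  · rw [WithTop.coe_inj]
    constructor
    · exact fun hc => ⟨Nat.find h, Nat.find_spec h, fun m hm => Nat.find_min h hm, hc⟩
    · rintro ⟨n, hn, hmin, hc⟩
      rwa [(Nat.find_eq_iff h).2 ⟨hn, hmin⟩]
  · constructor
    · exact fun hc => absurd hc (WithTop.coe_ne_top).symm
    · rintro ⟨n, hn, -⟩
      exact absurd ⟨n, hn⟩ h

/-- Positivity of a well-formed instance in terms of the winning region. -/
theorem positive_iff_winning (I : ESPInstance) (h0 : I.v0 < I.n)
    (hE : ∀ u : Fin I.n, ∃ v : Fin I.n, I.Edge u v) (hlen : I.cbar.length = I.t)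
    (ht : 0 < I.t) :
    I.Positive ↔ Winning I.Edge I.eveSet I.target (fun u v i => I.weight i u v) ⟨I.v0, h0⟩
      (fun i : Fin I.t => I.cbar.getD (i : ℕ) 0) := by
  have hcost : ∀ π : ℕ → Fin I.n,
      (∀ i : Fin I.t, costZ (I.weight i) I.target π =
          ((I.cbar.getD (i : ℕ) 0 : ℤ) : WithTop ℤ)) ↔
      ∃ n, π n ∈ I.target ∧ (∀ m < n, π m ∉ I.target) ∧
        accum (fun u v i => I.weight i u v) π n = fun i : Fin I.t => I.cbar.getD (i : ℕ) 0 := by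
    intro π
    simp only [costZ_eq_coe_iff]
    constructor
    · intro h
      obtain ⟨n, hn, hmin, -⟩ := h ⟨0, ht⟩
      refine ⟨n, hn, hmin, funext fun i => ?_⟩
      obtain ⟨m, hm, hmin', hc⟩ := h i
      have hmn : m = n := by
        rcases lt_trichotomy m n with hlt | rfl | hlt
        · exact absurd hm (hmin m hlt)
        · rfl
        · exact absurd hn (hmin' n hlt)
      subst hmn
      simpa [accum, Finset.sum_apply] using hc
    · rintro ⟨n, hn, hmin, hc⟩ i
      refine ⟨n, hn, hmin, ?_⟩
      simpa [accum, Finset.sum_apply] using congrFun hc i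
  constructor
  · rintro ⟨_, _, _, σ, hσ, h⟩
    exact winning_of_exists_strategy hE hσ fun π h1 h2 h3 => (hcost π).1 (h π h1 h2 h3)
  · intro h
    obtain ⟨σ, hσ, h⟩ := exists_strategy_of_winning hE h
    exact ⟨h0, hE, hlen, σ, hσ, fun π h1 h2 h3 => (hcost π).2 (h π h1 h2 h3)⟩

/-- The instance with the vertices `Fin N`, given edge relation, owners, weights and target. -/
noncomputable def ofGame (N t : ℕ) (E : Fin N → Fin N → Prop) (eve T : Set (Fin N))
    (w : Fin N → Fin N → Fin t → ℤ) (v₀ : Fin N) (c : List ℤ) : ESPInstance where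
  n := N
  t := t
  edges := ((List.finRange N ×ˢ List.finRange N).filter fun p => E p.1 p.2).map
    fun p => ((p.1 : ℕ), (p.2 : ℕ))
  eve := ((List.finRange N).filter fun v => v ∈ eve).map Fin.val
  w := (List.finRange t).map fun i => (List.finRange N ×ˢ List.finRange N).map
    fun p => ((p.1 : ℕ), (p.2 : ℕ), w p.1 p.2 i)
  tgt := ((List.finRange N).filter fun v => v ∈ T).map Fin.val
  v0 := v₀
  cbar := c

theorem sum_filter_pairs {N : ℕ} (w : Fin N → Fin N → ℤ) (u v : Fin N) :
    ((((List.finRange N ×ˢ List.finRange N).map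
      fun p => ((p.1 : ℕ), (p.2 : ℕ), w p.1 p.2)).filter
        fun p => p.1 == (u : ℕ) && p.2.1 == (v : ℕ)).map fun p => p.2.2).sum = w u v := by
  have hnd : (List.finRange N ×ˢ List.finRange N).Nodup :=
    (List.nodup_finRange N).product (List.nodup_finRange N)
  have hfil : (List.finRange N ×ˢ List.finRange N).filter (fun p => p = (u, v)) = [(u, v)] := by
    rw [List.filter_eq, List.count_eq_one_of_mem hnd (by simp)]
    rfl
  rw [List.filter_map, List.map_map]
  have hcongr : (List.finRange N ×ˢ List.finRange N).filter
      ((fun p : ℕ × ℕ × ℤ => p.1 == (u : ℕ) && p.2.1 == (v : ℕ)) ∘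
        fun p => ((p.1 : ℕ), (p.2 : ℕ), w p.1 p.2)) = [(u, v)] := by
    rw [← hfil]
    refine List.filter_congr fun p _ => ?_
    rw [Bool.eq_iff_iff]
    simp [Prod.ext_iff, Fin.ext_iff]
  rw [hcongr]
  simp

theorem mem_map_filter_pairs {N : ℕ} (E : Fin N → Fin N → Prop) (u v : Fin N) :
    ((u : ℕ), (v : ℕ)) ∈ ((List.finRange N ×ˢ List.finRange N).filter fun p => E p.1 p.2).map
      (fun p => ((p.1 : ℕ), (p.2 : ℕ))) ↔ E u v := by
  simp only [List.mem_map, List.mem_filter]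
  constructor
  · rintro ⟨⟨a, b⟩, ⟨-, h⟩, h'⟩
    obtain ⟨h1, h2⟩ := Prod.mk.inj h'
    rw [← Fin.ext h1, ← Fin.ext h2]
    simpa using h
  · exact fun h => ⟨(u, v), ⟨by simp, by simpa using h⟩, rfl⟩

theorem mem_map_filter_finRange {N : ℕ} (p : Fin N → Prop) (v : Fin N) :
    (v : ℕ) ∈ ((List.finRange N).filter fun v => p v).map Fin.val ↔ p v := by
  simp only [List.mem_map, List.mem_filter]
  constructor
  · rintro ⟨a, ⟨-, h⟩, h'⟩
    rw [← Fin.ext h']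
    simpa using h
  · exact fun h => ⟨v, ⟨by simp, by simpa using h⟩, rfl⟩

section
variable {N t : ℕ} (E : Fin N → Fin N → Prop) (eve T : Set (Fin N))
  (w : Fin N → Fin N → Fin t → ℤ) (v₀ : Fin N) (c : List ℤ)

theorem ofGame_edge : (ofGame N t E eve T w v₀ c).Edge = E :=
  funext fun u => funext fun v => propext (mem_map_filter_pairs E u v)

theorem ofGame_eveSet : (ofGame N t E eve T w v₀ c).eveSet = eve :=
  Set.ext fun v => mem_map_filter_finRange (· ∈ eve) v

theorem ofGame_target : (ofGame N t E eve T w v₀ c).target = T :=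
  Set.ext fun v => mem_map_filter_finRange (· ∈ T) v

theorem ofGame_weight (i : Fin t) (u v : Fin N) :
    (ofGame N t E eve T w v₀ c).weight i u v = w u v i := by
  have h : (ofGame N t E eve T w v₀ c).w.getD (i : ℕ) [] =
      (List.finRange N ×ˢ List.finRange N).map
        fun p => ((p.1 : ℕ), (p.2 : ℕ), w p.1 p.2 i) := by
    simp [ofGame, List.getD_eq_getElem?_getD]
  unfold weight
  rw [h]
  exact sum_filter_pairs (fun a b => w a b i) u v

theorem ofGame_positive_iff (hE : ∀ u, ∃ v, E u v) (hlen : c.length = t) (ht : 0 < t) :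
    (ofGame N t E eve T w v₀ c).Positive ↔
      Winning E eve T w v₀ (fun i : Fin t => c.getD (i : ℕ) 0) := by
  have hE' : ∀ u, ∃ v, (ofGame N t E eve T w v₀ c).Edge u v := by
    rw [ofGame_edge]
    exact hE
  rw [positive_iff_winning _ v₀.isLt hE' hlen ht, ofGame_edge, ofGame_eveSet, ofGame_target]
  have hw : (fun u v i => (ofGame N t E eve T w v₀ c).weight i u v) = w := by
    funext u v i
    exact ofGame_weight E eve T w v₀ c i u v
  rw [hw]
  rfl

end

/-- Varying only the first threshold entry over the naturals is computable. -/
theorem computable_ofGame {N t : ℕ} (E : Fin N → Fin N → Prop) (eve T : Set (Fin N))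
    (w : Fin N → Fin N → Fin t → ℤ) (v₀ : Fin N) (c : List ℤ) :
    Computable fun n : ℕ => ofGame N t E eve T w v₀ ((n : ℤ) :: c) := by
  have hcast : Primrec fun n : ℕ => (n : ℤ) := by
    have h : Primrec fun n : ℕ => Denumerable.ofNat ℤ (2 * n) :=
      (Primrec.ofNat ℤ).comp (Primrec.nat_mul.comp (Primrec.const 2) Primrec.id)
    refine h.of_eq fun n => ?_
    have henc : Encodable.encode (n : ℤ) = 2 * n := rfl
    rw [← henc, Denumerable.ofNat_encode]
  let J := ofGame N t E eve T w v₀ c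
  have h : Primrec fun n : ℕ => encEquiv.symm
      (J.n, J.t, J.edges, J.eve, J.w, J.tgt, J.v0, (n : ℤ) :: c) :=
    Primrec.of_equiv_symm.comp
      ((Primrec.const J.n).pair ((Primrec.const J.t).pair ((Primrec.const J.edges).pair
        ((Primrec.const J.eve).pair ((Primrec.const J.w).pair ((Primrec.const J.tgt).pair
          ((Primrec.const J.v0).pair (Primrec.list_cons.comp hcast (Primrec.const c)))))))))
  exact h.to_comp

end ESPInstance

namespace RegisterGame

open Nat.Partrec (Code)
open Function (update)

/-- Names of the relations on ten registers that are defined by mutual recursion. -/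
inductive RelName
  | mul
  | pair
  | fn (c : Code)

/-- Formulas about ten integer registers. They are the vertices of an (infinite) game graph, in
which Adam owns the conjunctions and Eve owns everything else. -/
inductive Formula
  | halt
  | loop (v : Fin 10 → ℤ) (P : Formula)
  | step (v : Fin 10 → ℤ) (P : Formula)
  | disj (P Q : Formula)
  | conj (P Q : Formula)
  | call (n : RelName)

namespace Formula

/-- The meaning of a formula, for a given interpretation of the relation names. -/
def Holds (J : RelName → (Fin 10 → ℤ) → Prop) : Formula → (Fin 10 → ℤ) → Prop
  | halt, r => r = 0
  | loop v P, r => ∃ z : ℕ, P.Holds J (r - z • v)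
  | step v P, r => P.Holds J (r - v)
  | disj P Q, r => P.Holds J r ∨ Q.Holds J r
  | conj P Q, r => P.Holds J r ∧ Q.Holds J r
  | call n, r => J n r

/-- Subtract a multiple of `D l` for every register `l`, then continue with `P`. -/
def loops (D : Fin 10 → Fin 10 → ℤ) (P : Formula) : Formula :=
  (List.finRange 10).foldr (fun l Q => loop (D l) Q) P

/-- All registers are nonnegative. -/
def nonneg : Formula := loops (fun l => Pi.single l 1) halt

/-- Existential quantification of register `i` over the natural numbers. -/
def ex (i : Fin 10) (P : Formula) : Formula :=
  loop (Pi.single i 1) (loop (Pi.single i (-1)) (conj nonneg P))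

/-- The equation expressing register `k` as the linear combination of the other registers with
coefficients `α`, plus `c`. -/
def lin (k : Fin 10) (α : Fin 10 → ℤ) (c : ℤ) : Formula :=
  loops (fun l => if l = k then 0 else Pi.single l 1 + Pi.single k (α l))
    (step (Pi.single k c) halt)

/-- Register `k` equals `c`. -/
def const (k : Fin 10) (c : ℕ) : Formula := lin k 0 c

/-- Register `k` equals register `i` plus `c`. -/
def shift (k i : Fin 10) (c : ℕ) : Formula := lin k (Pi.single i 1) c

/-- Register `k` equals the sum of the registers `i` and `j` plus `c`. -/
def sum (k i j : Fin 10) (c : ℕ) : Formula := lin k (Pi.single i 1 + Pi.single j 1) c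

/-- Copy register `i` to register `k`, then continue with `P`. -/
def set (k i : Fin 10) (P : Formula) : Formula := ex k (conj (shift k i 0) P)

section Semantics

variable (J : RelName → (Fin 10 → ℤ) → Prop)

/-- The meaning of a formula at natural register contents. -/
def Sat (P : Formula) (ν : Fin 10 → ℕ) : Prop := P.Holds J fun i => (ν i : ℤ)

theorem holds_foldr_loop (D : Fin 10 → Fin 10 → ℤ) (P : Formula) (L : List (Fin 10))
    (hL : L.Nodup) (r : Fin 10 → ℤ) :
    (L.foldr (fun l Q => loop (D l) Q) P).Holds J r ↔
      ∃ z : Fin 10 → ℕ, P.Holds J (r - (L.map fun l => z l • D l).sum) := by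
  induction L generalizing r with
  | nil => simp
  | cons a L ih =>
    rw [List.nodup_cons] at hL
    simp only [List.foldr_cons, Holds, ih hL.2, List.map_cons, List.sum_cons]
    constructor
    · rintro ⟨b, z, h⟩
      refine ⟨update z a b, ?_⟩
      have hmap : (L.map fun l => update z a b l • D l) = L.map fun l => z l • D l :=
        List.map_congr_left fun l hl => by
          have hne : l ≠ a := fun h' => hL.1 (h' ▸ hl)
          rw [Function.update_of_ne hne]
      rw [hmap, Function.update_self, ← sub_sub]
      exact h
    · rintro ⟨z, h⟩
      exact ⟨z a, z, by rwa [sub_sub]⟩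

theorem holds_loops (D : Fin 10 → Fin 10 → ℤ) (P : Formula) (r : Fin 10 → ℤ) :
    (loops D P).Holds J r ↔ ∃ z : Fin 10 → ℕ, P.Holds J (r - ∑ l, z l • D l) := by
  rw [loops, holds_foldr_loop J D P _ (List.nodup_finRange 10)]
  simp only [Fin.sum_univ_def]

theorem holds_nonneg (r : Fin 10 → ℤ) :
    nonneg.Holds J r ↔ ∃ ν : Fin 10 → ℕ, r = fun i => (ν i : ℤ) := by
  rw [nonneg, holds_loops]
  refine exists_congr fun z => ?_
  have hz : ∑ l, z l • (Pi.single l 1 : Fin 10 → ℤ) = fun i => (z i : ℤ) := by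
    funext i
    simp [Finset.sum_apply, Pi.single_apply]
  rw [hz]
  exact sub_eq_zero

@[simp]
theorem sat_ex (i : Fin 10) (P : Formula) (ν : Fin 10 → ℕ) :
    (ex i P).Sat J ν ↔ ∃ z : ℕ, P.Sat J (update ν i z) := by
  simp only [Sat, ex, Holds, holds_nonneg]
  constructor
  · rintro ⟨a, b, ⟨μ, hμ⟩, h⟩
    refine ⟨μ i, ?_⟩
    rw [hμ] at h
    convert h using 2 with j
    by_cases hj : j = i
    · subst hj
      simp
    · have := congrFun hμ j
      simp [hj] at this
      simp [hj, this]
  · rintro ⟨z, h⟩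
    have key : (fun j => (ν j : ℤ)) - ν i • (Pi.single i 1 : Fin 10 → ℤ) -
        z • (Pi.single i (-1) : Fin 10 → ℤ) = fun j => ((update ν i z j : ℕ) : ℤ) := by
      funext j
      by_cases hj : j = i
      · subst hj
        simp
      · simp [hj]
    exact ⟨ν i, z, ⟨_, key⟩, key ▸ h⟩

theorem sat_lin (k : Fin 10) (α : Fin 10 → ℤ) (hα : α k = 0) (c : ℤ) (ν : Fin 10 → ℕ) :
    (lin k α c).Sat J ν ↔ (ν k : ℤ) = ∑ l, α l * ν l + c := by
  have hsum : ∀ z : Fin 10 → ℕ, ∀ i, (∑ l, z l • (if l = k then 0 else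
      Pi.single l 1 + Pi.single k (α l) : Fin 10 → ℤ)) i =
        if i = k then ∑ l, α l * z l else (z i : ℤ) := by
    intro z i
    rw [Finset.sum_apply]
    split_ifs with hi
    · subst hi
      refine Finset.sum_congr rfl fun l _ => ?_
      by_cases hl : l = i
      · simp [hl, hα]
      · simp [hl, Ne.symm hl, mul_comm]
    · rw [Finset.sum_eq_single i]
      · simp [hi]
      · intro l _ hl
        by_cases hlk : l = k
        · simp [hlk]
        · simp [hlk, hi, Ne.symm hl]
      · simp
  rw [Sat, lin, holds_loops]
  simp only [Holds]
  constructor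
  · rintro ⟨z, hz⟩
    have hzν : ∀ i, i ≠ k → z i = ν i := by
      intro i hi
      have := congrFun hz i
      simp only [Pi.sub_apply, hsum, if_neg hi, Pi.single_eq_of_ne hi, Pi.zero_apply] at this
      omega
    have hk := congrFun hz k
    simp only [Pi.sub_apply, hsum, if_true, Pi.single_eq_same, Pi.zero_apply] at hk
    have : ∑ l, α l * (z l : ℤ) = ∑ l, α l * (ν l : ℤ) := by
      refine Finset.sum_congr rfl fun l _ => ?_
      by_cases hl : l = k
      · simp [hl, hα]
      · rw [hzν l hl]
    rw [this] at hk
    linarith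
  · intro h
    refine ⟨ν, funext fun i => ?_⟩
    simp only [Pi.sub_apply, hsum, Pi.zero_apply]
    by_cases hi : i = k
    · subst hi
      simp only [if_true, Pi.single_eq_same]
      linarith
    · simp [hi]

@[simp]
theorem sat_const (k : Fin 10) (c : ℕ) (ν : Fin 10 → ℕ) :
    (const k c).Sat J ν ↔ ν k = c := by
  rw [const, sat_lin J k 0 rfl]
  simp

@[simp]
theorem sat_shift {k i : Fin 10} (h : k ≠ i) (c : ℕ) (ν : Fin 10 → ℕ) :
    (shift k i c).Sat J ν ↔ ν k = ν i + c := by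
  rw [shift, sat_lin J k _ (by simp [h])]
  simp only [Pi.single_apply, ite_mul, one_mul, zero_mul, Finset.sum_ite_eq', Finset.mem_univ,
    if_true]
  norm_cast

@[simp]
theorem sat_sum {k i j : Fin 10} (hi : k ≠ i) (hj : k ≠ j) (c : ℕ) (ν : Fin 10 → ℕ) :
    (sum k i j c).Sat J ν ↔ ν k = ν i + ν j + c := by
  rw [sum, sat_lin J k _ (by simp [hi, hj])]
  simp only [Pi.add_apply, add_mul, Finset.sum_add_distrib, Pi.single_apply, ite_mul, one_mul,
    zero_mul, Finset.sum_ite_eq', Finset.mem_univ, if_true]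
  norm_cast

@[simp]
theorem sat_conj (P Q : Formula) (ν : Fin 10 → ℕ) :
    (conj P Q).Sat J ν ↔ P.Sat J ν ∧ Q.Sat J ν := Iff.rfl

@[simp]
theorem sat_disj (P Q : Formula) (ν : Fin 10 → ℕ) :
    (disj P Q).Sat J ν ↔ P.Sat J ν ∨ Q.Sat J ν := Iff.rfl

@[simp]
theorem sat_set {k i : Fin 10} (h : k ≠ i) (P : Formula) (ν : Fin 10 → ℕ) :
    (set k i P).Sat J ν ↔ P.Sat J (update ν k (ν i)) := by
  simp only [set, sat_ex, sat_conj, sat_shift J h, Function.update_self,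
    Function.update_of_ne h.symm, add_zero, exists_eq_left]

end Semantics

end Formula

open Formula

/-- The recursive definitions of the named relations: `mul` says that register `2` is the product
of the registers `0` and `1`, `pair` that register `2` is `Nat.pair` of the registers `0` and `1`,
and `fn c` that the code `c` evaluates at register `0` to register `1`. -/
def body : RelName → Formula
  | .mul =>
    disj (conj (const 0 0) (const 2 0))
      (ex 3 <| ex 4 <| conj (shift 0 3 1) <| conj (sum 2 4 1 0) <|
        set 0 3 <| set 2 4 <| call .mul)
  | .pair =>
    disj (ex 3 <| ex 4 <| conj (sum 1 0 4 1) <| conj (sum 2 3 0 0) <|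
        set 0 1 <| set 2 3 <| call .mul)
      (ex 3 <| ex 4 <| ex 5 <| conj (sum 0 1 4 0) <| conj (sum 5 3 0 0) <| conj (sum 2 5 1 0) <|
        set 1 0 <| set 2 3 <| call .mul)
  | .fn .zero => const 1 0
  | .fn .succ => shift 1 0 1
  | .fn .left => ex 3 <| set 2 0 <| set 0 1 <| set 1 3 <| call .pair
  | .fn .right => ex 3 <| set 2 0 <| set 0 3 <| call .pair
  | .fn (.pair f g) =>
    ex 3 <| ex 4 <| conj (set 1 3 <| call (.fn f)) <| conj (set 1 4 <| call (.fn g)) <|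
      set 2 1 <| set 0 3 <| set 1 4 <| call .pair
  | .fn (.comp f g) => ex 3 <| conj (set 1 3 <| call (.fn g)) <| set 0 3 <| call (.fn f)
  | .fn (.prec f g) =>
    ex 3 <| ex 4 <| conj (set 2 0 <| set 0 3 <| set 1 4 <| call .pair) <|
      disj (conj (const 4 0) (set 0 3 <| call (.fn f)))
        (ex 5 <| ex 6 <| ex 7 <| ex 8 <| ex 9 <| conj (shift 4 5 1) <|
          conj (set 0 3 <| set 1 5 <| set 2 7 <| call .pair) <|
          conj (set 0 7 <| set 1 6 <| call (.fn (.prec f g))) <|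
          conj (set 0 5 <| set 1 6 <| set 2 8 <| call .pair) <|
          conj (set 0 3 <| set 1 8 <| set 2 9 <| call .pair) <|
          set 0 9 <| call (.fn g))
  | .fn (.rfind' f) =>
    ex 3 <| ex 4 <| ex 5 <| conj (set 2 0 <| set 0 3 <| set 1 4 <| call .pair) <|
      conj (set 1 5 <| call (.fn f)) <|
      disj (conj (const 5 0) (shift 1 4 0))
        (ex 6 <| ex 7 <| ex 8 <| conj (shift 5 6 1) <| conj (shift 7 4 1) <|
          conj (set 0 3 <| set 1 7 <| set 2 8 <| call .pair) <|
          set 0 8 <| call (.fn (.rfind' f)))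

/-- The intended meaning of the named relations. -/
def Spec : RelName → (Fin 10 → ℕ) → Prop
  | .mul, ν => ν 0 * ν 1 = ν 2
  | .pair, ν => Nat.pair (ν 0) (ν 1) = ν 2
  | .fn c, ν => ν 1 ∈ c.eval (ν 0)

/-- The intended meaning, extended to integer register contents: no claim is made when some
register is negative. -/
def SpecInt (n : RelName) (r : Fin 10 → ℤ) : Prop :=
  ∀ ν : Fin 10 → ℕ, (r = fun i => (ν i : ℤ)) → Spec n ν

@[simp]
theorem sat_call_specInt (n : RelName) (ν : Fin 10 → ℕ) :
    (call n).Sat SpecInt ν ↔ Spec n ν := by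
  constructor
  · exact fun h => h ν rfl
  · intro h μ hμ
    have : ν = μ := funext fun i => Int.ofNat_inj.1 (congrFun hμ i)
    exact this ▸ h

/-- The interpretation `J` satisfies all rules of the recursive definitions. -/
def IsClosed (J : RelName → (Fin 10 → ℤ) → Prop) : Prop :=
  ∀ n r, (body n).Holds J r → J n r

theorem mem_eval_rfind' (f : Code) (a m y : ℕ) :
    y ∈ (Code.rfind' f).eval (Nat.pair a m) ↔
      ∃ v ∈ f.eval (Nat.pair a m),
        (v = 0 ∧ y = m) ∨ (v ≠ 0 ∧ y ∈ (Code.rfind' f).eval (Nat.pair a (m + 1))) := by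
  simp only [Code.eval, Nat.unpaired, Nat.unpair_pair, Part.mem_map_iff]
  constructor
  · rintro ⟨n, hn, rfl⟩
    obtain ⟨hn, hlt⟩ := Nat.mem_rfind.1 hn
    cases n with
    | zero =>
      obtain ⟨v, hv, h0⟩ := (Part.mem_map_iff _).1 hn
      exact ⟨v, by simpa using hv, Or.inl ⟨by simpa using h0, by simp⟩⟩
    | succ n =>
      obtain ⟨v, hv, h0⟩ := (Part.mem_map_iff _).1 (hlt (Nat.succ_pos n))
      refine ⟨v, by simpa using hv, Or.inr ⟨by simpa using h0, n,
        Nat.mem_rfind.2 ⟨?_, fun {k} hk => ?_⟩, by omega⟩⟩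
      · rwa [show n + (m + 1) = n + 1 + m by omega]
      · rw [show k + (m + 1) = k + 1 + m by omega]
        exact hlt (Nat.succ_lt_succ hk)
  · rintro ⟨v, hv, ⟨rfl, rfl⟩ | ⟨h0, n, hn, rfl⟩⟩
    · refine ⟨0, Nat.mem_rfind.2 ⟨(Part.mem_map_iff _).2 ⟨0, by simpa using hv, by simp⟩,
        fun {k} hk => ?_⟩, by simp⟩
      exact absurd hk (Nat.not_lt_zero k)
    · obtain ⟨hn, hlt⟩ := Nat.mem_rfind.1 hn
      refine ⟨n + 1, Nat.mem_rfind.2 ⟨?_, fun {k} hk => ?_⟩, by omega⟩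
      · rwa [show n + 1 + m = n + (m + 1) by omega]
      · cases k with
        | zero => exact (Part.mem_map_iff _).2 ⟨v, by simpa using hv, by simpa using h0⟩
        | succ k =>
          rw [show k + 1 + m = k + (m + 1) by omega]
          exact hlt (Nat.lt_of_succ_lt_succ hk)

theorem le_of_mem_eval_rfind' {f : Code} {a m y : ℕ}
    (h : y ∈ (Code.rfind' f).eval (Nat.pair a m)) : m ≤ y := by
  simp only [Code.eval, Nat.unpaired, Nat.unpair_pair, Part.mem_map_iff] at h
  obtain ⟨n, -, rfl⟩ := h
  exact Nat.le_add_left m n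

theorem spec_of_sat_body (n : RelName) (ν : Fin 10 → ℕ) (h : (body n).Sat SpecInt ν) :
    Spec n ν := by
  rcases n with _ | _ | c
  · simp [body, Spec] at h ⊢
    rcases h with ⟨h0, h2⟩ | ⟨a, h0, h2⟩
    · simp [h0, h2]
    · rw [h0, h2]
      ring
  · simp [body, Spec] at h ⊢
    rcases h with ⟨⟨d, h1⟩, h2⟩ | ⟨⟨d, h0⟩, h2⟩
    · rw [Nat.pair, if_pos (by omega), h2]
    · rw [Nat.pair, if_neg (by omega), h2]
  · cases c with
    | zero =>
      simp [body, Spec] at h ⊢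
      simp [h, Code.eval, pure, PFun.pure]
    | succ =>
      simp [body, Spec] at h ⊢
      simp [h, Code.eval]
    | left =>
      simp [body, Spec] at h ⊢
      obtain ⟨b, h⟩ := h
      simp [← h, Code.eval]
    | right =>
      simp [body, Spec] at h ⊢
      obtain ⟨a, h⟩ := h
      simp [← h, Code.eval]
    | pair f g =>
      simp [body, Spec] at h ⊢
      simpa [Code.eval, Seq.seq, eq_comm] using h
    | comp f g =>
      simp [body, Spec] at h ⊢
      exact Part.mem_bind_iff.2 h
    | prec f g =>
      simp [body, Spec] at h ⊢
      obtain ⟨a, n, h0, ⟨rfl, h⟩ | ⟨m, rfl, h⟩⟩ := h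
      · rwa [← h0, Code.eval_prec_zero]
      · rw [← h0, Code.eval_prec_succ]
        simpa using h
    | rfind' f =>
      simp [body, Spec] at h ⊢
      obtain ⟨a, m, h0, v, hv, h⟩ := h
      rw [← h0, mem_eval_rfind']
      exact ⟨v, h0 ▸ hv, by simpa [Nat.pos_iff_ne_zero] using h⟩

theorem isClosed_specInt : IsClosed SpecInt := by
  rintro n r h ν rfl
  exact spec_of_sat_body n ν h

section Completeness

variable {J : RelName → (Fin 10 → ℤ) → Prop}

theorem IsClosed.sat_call (hJ : IsClosed J) {n : RelName} {ν : Fin 10 → ℕ}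
    (h : (body n).Sat J ν) : (call n).Sat J ν := hJ n _ h

theorem IsClosed.sat_mul (hJ : IsClosed J) (ν : Fin 10 → ℕ) (h : ν 0 * ν 1 = ν 2) :
    (call .mul).Sat J ν := by
  obtain ⟨a, ha⟩ : ∃ a, ν 0 = a := ⟨_, rfl⟩
  induction a generalizing ν with
  | zero =>
    apply hJ.sat_call
    simp [body]
    left
    simp [← h, ha]
  | succ a ih =>
    apply hJ.sat_call
    simp [body]
    refine Or.inr ⟨a, ha, a * ν 1, ?_, ih _ ?_ ?_⟩
    · rw [← h, ha]
      ring
    · simp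
    · simp

theorem IsClosed.sat_pair (hJ : IsClosed J) (ν : Fin 10 → ℕ) (h : Nat.pair (ν 0) (ν 1) = ν 2) :
    (call .pair).Sat J ν := by
  apply hJ.sat_call
  simp [body]
  rw [Nat.pair] at h
  split_ifs at h with hlt
  · exact Or.inl ⟨ν 1 * ν 1, ν 1 - ν 0 - 1, by omega, h.symm, hJ.sat_mul _ (by simp)⟩
  · exact Or.inr ⟨ν 0 * ν 0, ν 0 - ν 1, by omega, h.symm, hJ.sat_mul _ (by simp)⟩

theorem IsClosed.sat_prec (hJ : IsClosed J) {f g : Code}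
    (hf : ∀ ν, Spec (.fn f) ν → (call (.fn f)).Sat J ν)
    (hg : ∀ ν, Spec (.fn g) ν → (call (.fn g)).Sat J ν) (a n : ℕ) (ν : Fin 10 → ℕ)
    (h0 : ν 0 = Nat.pair a n) (h : ν 1 ∈ (Code.prec f g).eval (Nat.pair a n)) :
    (call (.fn (.prec f g))).Sat J ν := by
  induction n generalizing ν with
  | zero =>
    rw [Code.eval_prec_zero] at h
    apply hJ.sat_call
    simp [body]
    exact ⟨a, 0, hJ.sat_pair _ (by simp [h0]), Or.inl ⟨rfl, hf _ (by simpa [Spec] using h)⟩⟩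
  | succ n ih =>
    rw [Code.eval_prec_succ] at h
    obtain ⟨i, hi, h⟩ := Part.mem_bind_iff.1 h
    apply hJ.sat_call
    simp [body]
    exact ⟨a, n + 1, hJ.sat_pair _ (by simp [h0]), Or.inr ⟨n, rfl, i, Nat.pair a n,
      Nat.pair n i, Nat.pair a (Nat.pair n i), hJ.sat_pair _ (by simp),
      ih _ (by simp) (by simpa using hi), hJ.sat_pair _ (by simp), hJ.sat_pair _ (by simp),
      hg _ (by simpa [Spec] using h)⟩⟩

theorem IsClosed.sat_rfind' (hJ : IsClosed J) {f : Code}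
    (hf : ∀ ν, Spec (.fn f) ν → (call (.fn f)).Sat J ν) (a m k : ℕ) (ν : Fin 10 → ℕ)
    (h0 : ν 0 = Nat.pair a m) (hk : ν 1 = m + k)
    (h : ν 1 ∈ (Code.rfind' f).eval (Nat.pair a m)) :
    (call (.fn (.rfind' f))).Sat J ν := by
  induction k generalizing m ν with
  | zero =>
    obtain ⟨v, hv, ⟨rfl, h⟩ | ⟨-, h⟩⟩ := (mem_eval_rfind' f a m (ν 1)).1 h
    · apply hJ.sat_call
      simp [body]
      exact ⟨a, m, 0, hJ.sat_pair _ (by simp [h0]), hf _ (by simpa [Spec, h0] using hv),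
        Or.inl ⟨rfl, h⟩⟩
    · have := le_of_mem_eval_rfind' h
      omega
  | succ k ih =>
    obtain ⟨v, hv, ⟨rfl, h⟩ | ⟨hv0, h⟩⟩ := (mem_eval_rfind' f a m (ν 1)).1 h
    · omega
    · apply hJ.sat_call
      simp [body]
      exact ⟨a, m, v, hJ.sat_pair _ (by simp [h0]), hf _ (by simpa [Spec, h0] using hv),
        Or.inr ⟨v - 1, by omega, Nat.pair a (m + 1), hJ.sat_pair _ (by simp),
          ih (m + 1) _ (by simp) (by simp; omega) (by simpa using h)⟩⟩

theorem IsClosed.sat_fn (hJ : IsClosed J) (c : Code) (ν : Fin 10 → ℕ)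
    (h : ν 1 ∈ c.eval (ν 0)) : (call (.fn c)).Sat J ν := by
  induction c generalizing ν with
  | zero =>
    apply hJ.sat_call
    simpa [body, Code.eval, pure, PFun.pure] using h
  | succ =>
    apply hJ.sat_call
    simpa [body, Code.eval] using h
  | left =>
    apply hJ.sat_call
    simp [Code.eval] at h
    simp [body]
    exact ⟨(ν 0).unpair.2, hJ.sat_pair _ (by simp [h])⟩
  | right =>
    apply hJ.sat_call
    simp [Code.eval] at h
    simp [body]
    exact ⟨(ν 0).unpair.1, hJ.sat_pair _ (by simp [h])⟩
  | pair f g hf hg =>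
    apply hJ.sat_call
    simp [Code.eval, Seq.seq] at h
    obtain ⟨x, hx, y, hy, h⟩ := h
    simp [body]
    exact ⟨x, y, hf _ (by simpa using hx), hg _ (by simpa using hy),
      hJ.sat_pair _ (by simp [h])⟩
  | comp f g hf hg =>
    apply hJ.sat_call
    obtain ⟨x, hx, h⟩ := Part.mem_bind_iff.1 h
    simp [body]
    exact ⟨x, hg _ (by simpa using hx), hf _ (by simpa using h)⟩
  | prec f g hf hg =>
    refine hJ.sat_prec hf hg (ν 0).unpair.1 (ν 0).unpair.2 ν (by simp) ?_
    rwa [Nat.pair_unpair]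
  | rfind' f hf =>
    have h' : ν 1 ∈ (Code.rfind' f).eval (Nat.pair (ν 0).unpair.1 (ν 0).unpair.2) := by
      rwa [Nat.pair_unpair]
    have hle := le_of_mem_eval_rfind' h'
    exact hJ.sat_rfind' hf (ν 0).unpair.1 (ν 0).unpair.2 (ν 1 - (ν 0).unpair.2) ν (by simp)
      (by omega) h'

end Completeness

/-- The successors of a formula in the game graph. -/
def successors : Formula → List Formula
  | halt => [halt]
  | loop v P => [loop v P, P]
  | step _ P => [P]
  | disj P Q => [P, Q]
  | conj P Q => [P, Q]
  | call n => [body n]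

/-- The weight vectors of the edges of the game graph. -/
noncomputable def edgeWeight : Formula → Formula → Fin 10 → ℤ
  | loop v P, Q => if Q = loop v P then v else 0
  | step v _, _ => v
  | _, _ => 0

/-- The edge relation of the game graph. -/
def Move (P Q : Formula) : Prop := Q ∈ successors P

/-- The formulas owned by Eve. -/
def eveFormulas : Set Formula := {P | ∀ A B, P ≠ conj A B}

theorem exists_move (P : Formula) : ∃ Q, Move P Q := by
  cases P <;> simp [Move, successors]

/-- `WinWithin` in the graph of formulas. -/
abbrev FWinWithin : ℕ → Formula → (Fin 10 → ℤ) → Prop :=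
  WinWithin Move eveFormulas {halt} edgeWeight

/-- `Winning` in the graph of formulas. -/
abbrev FWinning : Formula → (Fin 10 → ℤ) → Prop :=
  Winning Move eveFormulas {halt} edgeWeight

theorem ne_loop (v : Fin 10 → ℤ) (P : Formula) : P ≠ loop v P := by
  intro h
  have := congrArg sizeOf h
  simp at this

theorem holds_of_winWithin {J : RelName → (Fin 10 → ℤ) → Prop} (hJ : IsClosed J) (k : ℕ)
    (P : Formula) (r : Fin 10 → ℤ) (h : FWinWithin k P r) : P.Holds J r := by
  induction k generalizing P r with
  | zero => exact h.elim
  | succ k ih =>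
    rcases h with ⟨hT, rfl⟩ | ⟨hT, he, Q, hQ, h⟩ | ⟨hT, he, h⟩
    · rw [Set.mem_singleton_iff.1 hT]
      rfl
    · have hQ' := ih Q _ h
      cases P with
      | halt => exact absurd rfl hT
      | loop v P =>
        simp only [Move, successors, List.mem_cons, List.not_mem_nil, or_false] at hQ
        rcases hQ with rfl | rfl
        · simp only [edgeWeight, if_true] at hQ'
          obtain ⟨z, hz⟩ := hQ'
          refine ⟨z + 1, ?_⟩
          rwa [succ_nsmul', ← sub_sub]
        · simp only [edgeWeight, if_neg (ne_loop v Q)] at hQ'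
          exact ⟨0, by simpa using hQ'⟩
      | step v P =>
        simp only [Move, successors, List.mem_singleton] at hQ
        subst hQ
        exact hQ'
      | disj A B =>
        simp only [Move, successors, List.mem_cons, List.not_mem_nil, or_false] at hQ
        simp only [edgeWeight, sub_zero] at hQ'
        rcases hQ with rfl | rfl
        · exact Or.inl hQ'
        · exact Or.inr hQ'
      | conj A B => exact absurd rfl (he A B)
      | call n =>
        simp only [Move, successors, List.mem_singleton] at hQ
        subst hQ
        simp only [edgeWeight, sub_zero] at hQ'
        exact hJ n r hQ'
    · have he' : ∃ A B, P = conj A B := by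
        by_contra! hno
        exact he hno
      obtain ⟨A, B, rfl⟩ := he'
      have hA := ih A _ (h A (by simp [Move, successors]))
      have hB := ih B _ (h B (by simp [Move, successors]))
      simp only [edgeWeight, sub_zero] at hA hB
      exact ⟨hA, hB⟩

/-- The interpretation of the relation names by the winning region. -/
def winInterp (n : RelName) (r : Fin 10 → ℤ) : Prop := FWinning (call n) r

theorem winning_of_holds (P : Formula) (r : Fin 10 → ℤ) (h : P.Holds winInterp r) :
    FWinning P r := by
  induction P generalizing r with
  | halt =>
    obtain rfl : r = 0 := h
    exact winning_of_mem_target rfl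
  | loop v P ih =>
    obtain ⟨z, h⟩ := h
    have hT : loop v P ∉ ({halt} : Set Formula) := by simp
    have he : loop v P ∈ eveFormulas := fun A B => by simp
    induction z generalizing r with
    | zero =>
      refine winning_of_eve (u := P) hT he (by simp [Move, successors]) (ih _ ?_)
      simpa [edgeWeight, ne_loop v P] using h
    | succ z ihz =>
      refine winning_of_eve (u := loop v P) hT he (by simp [Move, successors]) (ihz _ ?_)
      rw [succ_nsmul', ← sub_sub] at h
      simpa [edgeWeight] using h
  | step v P ih =>
    exact winning_of_eve (u := P) (by simp) (fun A B => by simp) (by simp [Move, successors])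
      (ih _ h)
  | disj A B ihA ihB =>
    rcases h with h | h
    · exact winning_of_eve (u := A) (by simp) (fun A B => by simp) (by simp [Move, successors])
        (ihA _ (by simpa [edgeWeight] using h))
    · exact winning_of_eve (u := B) (by simp) (fun A B => by simp) (by simp [Move, successors])
        (ihB _ (by simpa [edgeWeight] using h))
  | conj A B ihA ihB =>
    obtain ⟨k, hk⟩ := ihA _ h.1
    obtain ⟨m, hm⟩ := ihB _ h.2
    refine ⟨max k m + 1, Or.inr (Or.inr ⟨by simp, fun he => he A B rfl, fun Q hQ => ?_⟩)⟩
    simp only [Move, successors, List.mem_cons, List.not_mem_nil, or_false] at hQ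
    simp only [edgeWeight, sub_zero]
    rcases hQ with rfl | rfl
    · exact hk.mono (le_max_left _ _)
    · exact hm.mono (le_max_right _ _)
  | call n => exact h

theorem isClosed_winInterp : IsClosed winInterp := by
  intro n r h
  refine winning_of_eve (u := body n) (by simp) (fun A B => by simp) (by simp [Move, successors]) ?_
  simpa [edgeWeight] using winning_of_holds _ _ h

/-- The formula expressing that the code `c` halts on register `0`. -/
def haltsFormula (c : Code) : Formula := ex 1 (call (.fn c))

theorem winning_haltsFormula_iff (c : Code) (ν : Fin 10 → ℕ) :
    FWinning (haltsFormula c) (fun i => (ν i : ℤ)) ↔ (c.eval (ν 0)).Dom := by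
  rw [Part.dom_iff_mem]
  constructor
  · rintro ⟨k, hk⟩
    have h : (haltsFormula c).Sat SpecInt ν := holds_of_winWithin isClosed_specInt k _ _ hk
    simpa [haltsFormula, Spec] using h
  · rintro ⟨y, hy⟩
    refine winning_of_holds _ _ ?_
    change (haltsFormula c).Sat winInterp ν
    rw [haltsFormula, sat_ex]
    exact ⟨y, isClosed_winInterp.sat_fn c _ (by simpa using hy)⟩

/-- The subformulas of a formula, without unfolding named relations. -/
def subformulas : Formula → Set Formula
  | halt => {halt}
  | loop v P => insert (loop v P) (subformulas P)
  | step v P => insert (step v P) (subformulas P)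
  | disj P Q => insert (disj P Q) (subformulas P ∪ subformulas Q)
  | conj P Q => insert (conj P Q) (subformulas P ∪ subformulas Q)
  | call n => {call n}

/-- The relation names occurring in a formula. -/
def names : Formula → Set RelName
  | halt => ∅
  | loop _ P => names P
  | step _ P => names P
  | disj P Q => names P ∪ names Q
  | conj P Q => names P ∪ names Q
  | call n => {n}

theorem finite_subformulas (P : Formula) : (subformulas P).Finite := by
  induction P with
  | halt => exact Set.finite_singleton _
  | loop v P ih => exact ih.insert _
  | step v P ih => exact ih.insert _
  | disj P Q ihP ihQ => exact (ihP.union ihQ).insert _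
  | conj P Q ihP ihQ => exact (ihP.union ihQ).insert _
  | call n => exact Set.finite_singleton _

theorem self_mem_subformulas (P : Formula) : P ∈ subformulas P := by
  cases P <;> simp [subformulas]

theorem move_subformulas {P Q R : Formula} (hQ : Q ∈ subformulas P) (h : Move Q R) :
    R ∈ subformulas P ∨ ∃ n ∈ names P, R = body n := by
  induction P with
  | halt =>
    obtain rfl : Q = halt := hQ
    left
    simpa [Move, successors, subformulas] using h
  | loop v P ih =>
    rcases hQ with rfl | hQ
    · left
      simp only [Move, successors, List.mem_cons, List.not_mem_nil, or_false] at h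
      rcases h with rfl | rfl
      · exact Or.inl rfl
      · exact Or.inr (self_mem_subformulas _)
    · exact (ih hQ).imp Or.inr id
  | step v P ih =>
    rcases hQ with rfl | hQ
    · left
      simp only [Move, successors, List.mem_singleton] at h
      subst h
      exact Or.inr (self_mem_subformulas _)
    · exact (ih hQ).imp Or.inr id
  | disj A B ihA ihB =>
    rcases hQ with rfl | hQ | hQ
    · left
      simp only [Move, successors, List.mem_cons, List.not_mem_nil, or_false] at h
      rcases h with rfl | rfl
      · exact Or.inr (Or.inl (self_mem_subformulas _))
      · exact Or.inr (Or.inr (self_mem_subformulas _))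
    · exact (ihA hQ).imp (fun h => Or.inr (Or.inl h)) fun ⟨n, hn, h⟩ => ⟨n, Or.inl hn, h⟩
    · exact (ihB hQ).imp (fun h => Or.inr (Or.inr h)) fun ⟨n, hn, h⟩ => ⟨n, Or.inr hn, h⟩
  | conj A B ihA ihB =>
    rcases hQ with rfl | hQ | hQ
    · left
      simp only [Move, successors, List.mem_cons, List.not_mem_nil, or_false] at h
      rcases h with rfl | rfl
      · exact Or.inr (Or.inl (self_mem_subformulas _))
      · exact Or.inr (Or.inr (self_mem_subformulas _))
    · exact (ihA hQ).imp (fun h => Or.inr (Or.inl h)) fun ⟨n, hn, h⟩ => ⟨n, Or.inl hn, h⟩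
    · exact (ihB hQ).imp (fun h => Or.inr (Or.inr h)) fun ⟨n, hn, h⟩ => ⟨n, Or.inr hn, h⟩
  | call n =>
    obtain rfl : Q = call n := hQ
    right
    exact ⟨n, rfl, by simpa [Move, successors] using h⟩

theorem names_loops (D : Fin 10 → Fin 10 → ℤ) (P : Formula) : names (loops D P) = names P := by
  unfold loops
  induction List.finRange 10 with
  | nil => rfl
  | cons a L ih => exact ih

theorem names_lin (k : Fin 10) (α : Fin 10 → ℤ) (c : ℤ) : names (lin k α c) = ∅ :=
  names_loops _ _

theorem names_ex (i : Fin 10) (P : Formula) : names (ex i P) = names P := by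
  simp [ex, names, nonneg, names_loops]

theorem names_set (k i : Fin 10) (P : Formula) : names (Formula.set k i P) = names P := by
  simp [Formula.set, names_ex, names, Formula.shift, names_lin]

/-- The relation names on which the definition of `fn c` depends. -/
def dependencies : Code → Set RelName
  | .zero => {.fn .zero, .mul, .pair}
  | .succ => {.fn .succ, .mul, .pair}
  | .left => {.fn .left, .mul, .pair}
  | .right => {.fn .right, .mul, .pair}
  | .pair f g => insert (.fn (.pair f g)) (dependencies f ∪ dependencies g)
  | .comp f g => insert (.fn (.comp f g)) (dependencies f ∪ dependencies g)
  | .prec f g => insert (.fn (.prec f g)) (dependencies f ∪ dependencies g)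
  | .rfind' f => insert (.fn (.rfind' f)) (dependencies f)

theorem finite_dependencies (c : Code) : (dependencies c).Finite := by
  induction c with
  | zero | succ | left | right => simp [dependencies]
  | pair f g hf hg => exact (hf.union hg).insert _
  | comp f g hf hg => exact (hf.union hg).insert _
  | prec f g hf hg => exact (hf.union hg).insert _
  | rfind' f hf => exact hf.insert _

theorem fn_mem_dependencies (c : Code) : RelName.fn c ∈ dependencies c := by
  cases c <;> simp [dependencies]

theorem mul_mem_dependencies (c : Code) : RelName.mul ∈ dependencies c := by
  induction c <;> simp_all [dependencies]

theorem pair_mem_dependencies (c : Code) : RelName.pair ∈ dependencies c := by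
  induction c <;> simp_all [dependencies]

theorem names_body_mul_subset (c : Code) : names (body .mul) ⊆ dependencies c := by
  simp [body, names, names_ex, names_set, Formula.const, Formula.shift, Formula.sum, names_lin,
    mul_mem_dependencies]

theorem names_body_pair_subset (c : Code) : names (body .pair) ⊆ dependencies c := by
  simp [body, names, names_ex, names_set, Formula.sum, names_lin, mul_mem_dependencies]

theorem names_body_subset {c : Code} {n : RelName} (hn : n ∈ dependencies c) :
    names (body n) ⊆ dependencies c := by
  induction c with
  | zero | succ | left | right =>
    rcases hn with rfl | rfl | rfl
    · simp [body, names, names_ex, names_set, Formula.const, Formula.shift, names_lin,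
        pair_mem_dependencies]
    · exact names_body_mul_subset _
    · exact names_body_pair_subset _
  | pair f g hf hg | comp f g hf hg | prec f g hf hg =>
    rcases hn with rfl | hn | hn
    · simp [body, names, names_ex, names_set, Formula.const, Formula.shift, names_lin,
        dependencies, Set.insert_subset_iff, fn_mem_dependencies, pair_mem_dependencies]
    · exact ((hf hn).trans Set.subset_union_left).trans (Set.subset_insert _ _)
    · exact ((hg hn).trans Set.subset_union_right).trans (Set.subset_insert _ _)
  | rfind' f hf =>
    rcases hn with rfl | hn
    · simp [body, names, names_ex, names_set, Formula.const, Formula.shift, names_lin,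
        dependencies, Set.insert_subset_iff, fn_mem_dependencies, pair_mem_dependencies]
    · exact (hf hn).trans (Set.subset_insert _ _)

/-- The part of the game graph reachable from `haltsFormula c`. -/
def arena (c : Code) : Set Formula :=
  subformulas (haltsFormula c) ∪ ⋃ n ∈ dependencies c, subformulas (body n)

theorem finite_arena (c : Code) : (arena c).Finite :=
  (finite_subformulas _).union ((finite_dependencies c).biUnion fun _ _ => finite_subformulas _)

theorem move_mem_arena {c : Code} {P Q : Formula} (hP : P ∈ arena c) (h : Move P Q) :
    Q ∈ arena c := by
  have hbody : ∀ n ∈ dependencies c, subformulas (body n) ⊆ arena c := fun n hn =>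
    (Set.subset_biUnion_of_mem (u := fun n => subformulas (body n)) hn).trans
      Set.subset_union_right
  rcases hP with hP | hP
  · rcases move_subformulas hP h with hQ | ⟨n, hn, rfl⟩
    · exact Or.inl hQ
    · obtain rfl : n = .fn c := by simpa [haltsFormula, names_ex, names] using hn
      exact hbody _ (fn_mem_dependencies c) (self_mem_subformulas _)
  · simp only [Set.mem_iUnion] at hP
    obtain ⟨m, hm, hP⟩ := hP
    rcases move_subformulas hP h with hQ | ⟨n, hn, rfl⟩
    · exact hbody m hm hQ
    · exact hbody n (names_body_subset hm hn) (self_mem_subformulas _)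

/-- For every code there is a computable family of instances of the Equality Shortest Path problem
that are positive exactly when the code halts. -/
theorem exists_computable_positive_iff (c : Code) :
    ∃ F : ℕ → ESPInstance, Computable F ∧ ∀ n, (F n).Positive ↔ (c.eval n).Dom := by
  have := (finite_arena c).to_subtype
  obtain ⟨N, ⟨e⟩⟩ := Finite.exists_equiv_fin (arena c)
  let f : Fin N → Formula := fun a => e.symm a
  have hmem : ∀ {P}, P ∈ arena c → ∃ a, f a = P := fun {P} hP =>
    ⟨e ⟨P, hP⟩, congrArg Subtype.val (e.symm_apply_apply _)⟩
  have hclosed : ∀ a Q, Move (f a) Q → ∃ b, f b = Q := fun a Q h =>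
    hmem (move_mem_arena (e.symm a).2 h)
  obtain ⟨v₀, hv₀⟩ := hmem (Or.inl (self_mem_subformulas (haltsFormula c)))
  refine ⟨_, ESPInstance.computable_ofGame (fun a b => Move (f a) (f b)) {a | f a ∈ eveFormulas}
    {a | f a ∈ ({halt} : Set Formula)} (fun a b => edgeWeight (f a) (f b)) v₀
    (List.replicate 9 0), fun n => ?_⟩
  have hserial : ∀ a, ∃ b, Move (f a) (f b) := fun a => by
    obtain ⟨Q, hQ⟩ := exists_move (f a)
    obtain ⟨b, rfl⟩ := hclosed a Q hQ
    exact ⟨b, hQ⟩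
  have hc : (fun i : Fin 10 => ((n : ℤ) :: List.replicate 9 0).getD (i : ℕ) 0) =
      fun i => ((Pi.single 0 n : Fin 10 → ℕ) i : ℤ) := by
    funext i
    fin_cases i <;> simp
  rw [ESPInstance.ofGame_positive_iff _ _ _ _ _ _ hserial (by simp) (by norm_num), hc]
  have hwin := winning_haltsFormula_iff c (Pi.single 0 n)
  rw [Pi.single_eq_same, ← hv₀] at hwin
  rw [← hwin]
  exact exists_congr fun k => winWithin_embedding f (fun _ _ => Iff.rfl) hclosed
    (fun _ => Iff.rfl) (fun _ => Iff.rfl) (fun _ _ _ => rfl) k v₀ _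

theorem exists_universal_code :
    ∃ u : Code, ∀ n, u.eval n = (Denumerable.ofNat Code n).eval 0 := by
  have h : Partrec fun n => (Denumerable.ofNat Code n).eval 0 :=
    Code.eval_part.comp (Computable.ofNat Code) (Computable.const 0)
  obtain ⟨u, hu⟩ := Code.exists_code.1 (Partrec.nat_iff.1 h)
  exact ⟨u, congrFun hu⟩

end RegisterGame

/-- The two-player zero-sum multidimensional Equality Shortest Path problem is
undecidable: the set of positive instances is not a computable (decidable) set. -/
theorem ESP_undecidable : ¬ ComputablePred ESPInstance.Positive := by
  intro h
  obtain ⟨u, hu⟩ := RegisterGame.exists_universal_code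
  obtain ⟨F, hF, hpos⟩ := RegisterGame.exists_computable_positive_iff u
  refine ComputablePred.halting_problem 0 (ComputablePred.computable_of_manyOneReducible
    ⟨fun c => F (Encodable.encode c), hF.comp Computable.encode, fun c => ?_⟩ h)
  rw [hpos, hu, Denumerable.ofNat_encode]
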